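/- Let p : ℕ → ℕ be admissible, let α : ℕ → ℕ satisfy α(n) = O(n), let ε ≥ 0 be a constant real number, and for each n ≥ 2 let t_n be an α(n)-almost supermagic edge labeling of K_n. Suppose that for each n there exist pairwise disjoint 1-APs I₁,…,I_{m(n)} ⊆ {1,…,ε_n}, each of length at least 4p(n), and a set T_n of at least log n vertices of K_n such that every v ∈ T_n satisfies |S(t_n,v) ∩ (I₁∪…∪I_{m(n)})| ≥ n − 1 − ε√n and |S(t_n,v) ∩ I_i| ≤ 2 for every i ∈ [m(n)]. Then for every constant positive integer h there exists a magnitude sequence p* with p(n) − h + 1 ≤ p*(n) ≤ p(n) for all n such that limsup_{n→∞} R(p*(n), t_n, n)/(2·p*(n)·n) ≥ 1 − (3 + ε²)/(2h); in particular, limsup_{n→∞} R(p(n), t_n, n)/(2·p(n)·n) ≥ 1 − (3 + ε²)/(2h). -/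

import Mathlib

open Finset

namespace Swap

noncomputable section
open scoped Classical

def eps (n : ℕ) : ℕ := n * (n - 1) / 2

def incEdges (n : ℕ) (v : Fin n) : Finset (Sym2 (Fin n)) :=
  Finset.univ.filter fun e => v ∈ e ∧ ¬ e.IsDiag

def IsEdgeLabeling (n : ℕ) (t : Sym2 (Fin n) → ℕ) : Prop :=
  Set.BijOn t {e : Sym2 (Fin n) | ¬ e.IsDiag} (Set.Icc 1 (eps n))

def labelSum (n : ℕ) (t : Sym2 (Fin n) → ℕ) (v : Fin n) : ℤ :=
  ∑ e ∈ incEdges n v, (t e : ℤ)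

def labelSet (n : ℕ) (t : Sym2 (Fin n) → ℕ) (v : Fin n) : Finset ℕ :=
  (incEdges n v).image t

def AlmostSupermagic (n α : ℕ) (t : Sym2 (Fin n) → ℕ) : Prop :=
  IsEdgeLabeling n t ∧ ∀ u v : Fin n, |labelSum n t u - labelSum n t v| ≤ (α : ℤ)

def IsPSwap (n p : ℕ) (t t' : Sym2 (Fin n) → ℕ) : Prop :=
  IsEdgeLabeling n t' ∧ ∀ e : Sym2 (Fin n), ¬ e.IsDiag → |(t' e : ℤ) - (t e : ℤ)| ≤ (p : ℤ)

def robustness (n p : ℕ) (t : Sym2 (Fin n) → ℕ) : ℕ :=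
  sSup {d : ℕ | ∃ t' : Sym2 (Fin n) → ℕ, IsPSwap n p t t' ∧
    ∃ u v : Fin n, u ≠ v ∧ (d : ℤ) = |labelSum n t' u - labelSum n t' v|}

def Uplus (n p : ℕ) (t : Sym2 (Fin n) → ℕ) (v : Fin n) : Finset (Sym2 (Fin n)) :=
  (incEdges n v).filter fun e => ∃ e' ∈ incEdges n v, t e' = t e + p

def Uminus (n p : ℕ) (t : Sym2 (Fin n) → ℕ) (v : Fin n) : Finset (Sym2 (Fin n)) :=
  (incEdges n v).filter fun e => ∃ e' ∈ incEdges n v, t e' + p = t e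

def badPairsI (n p : ℕ) (t : Sym2 (Fin n) → ℕ) (u v : Fin n) :
    Finset (Sym2 (Sym2 (Fin n))) :=
  Finset.univ.filter fun P => ∃ e₁ e₂ : Sym2 (Fin n), P = s(e₁, e₂) ∧
    ¬ e₁.IsDiag ∧ ¬ e₂.IsDiag ∧ u ∈ e₁ ∧ v ∈ e₂ ∧ ((t e₁ : ℤ) - (t e₂ : ℤ)).natAbs = p

def badPairsII (n p : ℕ) (t : Sym2 (Fin n) → ℕ) (u v : Fin n) :
    Finset (Sym2 (Sym2 (Fin n))) :=
  Finset.univ.filter fun P => ∃ e₁ e₂ : Sym2 (Fin n), P = s(e₁, e₂) ∧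
    ¬ e₁.IsDiag ∧ ¬ e₂.IsDiag ∧ u ∈ e₁ ∧ v ∈ e₂ ∧ ((t e₁ : ℤ) - (t e₂ : ℤ)).natAbs = 2 * p

def badPairs (n p : ℕ) (t : Sym2 (Fin n) → ℕ) (u v : Fin n) :
    Finset (Sym2 (Sym2 (Fin n))) :=
  badPairsI n p t u v ∪ badPairsII n p t u v

def IsAP1 (I : Finset ℕ) : Prop := ∃ a b : ℕ, a ≤ b ∧ I = Finset.Icc a b

def SetHasType (p m ℓ : ℕ) (S : Finset ℕ) : Prop :=
  ∃ 𝒜 : Finset (Finset ℕ), 𝒜.card ≤ m ∧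
    (∀ I ∈ 𝒜, IsAP1 I ∧ I ⊆ S ∧ 2 * p ≤ I.card) ∧
    (𝒜 : Set (Finset ℕ)).PairwiseDisjoint id ∧
    ℓ ≤ ∑ I ∈ 𝒜, I.card

def LabelingHasType (n p m ℓ : ℕ) (t : Sym2 (Fin n) → ℕ) : Prop :=
  ∀ v : Fin n, SetHasType p m ℓ (labelSet n t v)

def AstrayGood (n b : ℕ) (t : Sym2 (Fin n) → ℕ) : Prop :=
  IsEdgeLabeling n t ∧
  ∃ A : Finset (Sym2 (Fin n)), (∀ e ∈ A, ¬ e.IsDiag) ∧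
    A.card % 2 = eps n % 2 ∧
    A.image t = Finset.Icc ((eps n - A.card) / 2 + 1) ((eps n + A.card) / 2) ∧
    ∀ v : Fin n,
      (incEdges n v ∩ A).card ≤ b ∧
      ((incEdges n v).filter fun e => t e ≤ (eps n - A.card) / 2).card
        = ((incEdges n v).filter fun e => (eps n + A.card) / 2 < t e).card ∧
      2 * ∑ e ∈ incEdges n v \ A, t e = (incEdges n v \ A).card * (eps n + 1)

def Admissible (p : ℕ → ℕ) : Prop :=
  Filter.Tendsto (fun n => (p n : ℝ) / n) Filter.atTop (nhds 0) ∧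
  Filter.Tendsto p Filter.atTop Filter.atTop

end
end Swap

namespace SwapAux

/-- Labels of `A` that can be moved up by `q`. -/
def goodA (E c q : ℤ) (A B : Finset ℤ) : Finset ℤ :=
  A.filter fun x => x ≠ c ∧ x + q ≤ E ∧ x + q ∉ A ∧ x + q ∉ B ∧ x + 2 * q ∉ B

/-- Labels of `B` that can be moved down by `q`. -/
def goodB (c q : ℤ) (A B : Finset ℤ) : Finset ℤ :=
  B.filter fun y => y ≠ c ∧ 1 ≤ y - q ∧ y - q ∉ A ∧ y - q ∉ B ∧ y - 2 * q ∉ A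

/-- The product of the disjoint transpositions. -/
def swp (E c q : ℤ) (A B : Finset ℤ) (z : ℤ) : ℤ :=
  if z ∈ goodA E c q A B ∨ z + q ∈ goodB c q A B then z + q
  else if z - q ∈ goodA E c q A B ∨ z ∈ goodB c q A B then z - q else z

lemma swp_cases (E c q : ℤ) (A B : Finset ℤ) (z : ℤ) :
    (swp E c q A B z = z + q ∧ (z ∈ goodA E c q A B ∨ z + q ∈ goodB c q A B)) ∨
    (swp E c q A B z = z - q ∧ (z - q ∈ goodA E c q A B ∨ z ∈ goodB c q A B)) ∨
    swp E c q A B z = z := by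
  unfold swp; split_ifs <;> simp_all

lemma swp_invol (E c q : ℤ) (A B : Finset ℤ) (hc : ∀ x, x ∈ A → x ∈ B → x = c) (z : ℤ) :
    swp E c q A B (swp E c q A B z) = z := by
  unfold swp
  have e1 : ∀ z : ℤ, z + q - q = z := fun z => by ring
  have e2 : ∀ z : ℤ, z - q + q = z := fun z => by ring
  by_cases h1 : z ∈ goodA E c q A B ∨ z + q ∈ goodB c q A B
  · have h3 : ¬ (z + q ∈ goodA E c q A B ∨ z + q + q ∈ goodB c q A B) := by
      have e3 : z + q + q = z + 2 * q := by ring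
      have e4 : z + q + q - 2 * q = z := by ring
      simp only [goodA, goodB, mem_filter, e1, e4] at h1 ⊢
      have := hc (z + q)
      rw [e3]
      tauto
    simp only [h1, h3, if_true, if_false, e1]
  · by_cases h2 : z - q ∈ goodA E c q A B ∨ z ∈ goodB c q A B
    · simp only [h1, h2, if_true, if_false, e2]
    · simp only [h1, h2, if_false]

lemma swp_range (E c q : ℤ) (A B : Finset ℤ) (hq : 0 ≤ q)
    (hA : ∀ x ∈ A, 1 ≤ x ∧ x ≤ E) (hB : ∀ x ∈ B, 1 ≤ x ∧ x ≤ E) (z : ℤ)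
    (hz : 1 ≤ z ∧ z ≤ E) :
    1 ≤ swp E c q A B z ∧ swp E c q A B z ≤ E := by
  rcases swp_cases E c q A B z with ⟨h, h'⟩ | ⟨h, h'⟩ | h
  · rw [h]; simp only [goodA, goodB, mem_filter] at h'
    rcases h' with h' | h'
    · omega
    · have := hB _ h'.1; omega
  · rw [h]; simp only [goodA, goodB, mem_filter] at h'
    rcases h' with h' | h'
    · have := hA _ h'.1; omega
    · omega
  · rw [h]; exact hz

lemma swp_dist (E c q : ℤ) (A B : Finset ℤ) (hq : 0 ≤ q) (z : ℤ) :
    |swp E c q A B z - z| ≤ q := by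
  rw [abs_le]
  rcases swp_cases E c q A B z with ⟨h, h'⟩ | ⟨h, h'⟩ | h <;> omega

lemma swp_sumA (E c q : ℤ) (A B : Finset ℤ) (hc : ∀ x, x ∈ A → x ∈ B → x = c) :
    ∑ x ∈ A, swp E c q A B x = ∑ x ∈ A, x + q * (goodA E c q A B).card := by
  have : ∀ x ∈ A, swp E c q A B x = x + if x ∈ goodA E c q A B then q else 0 := by
    intro x hx
    unfold swp
    by_cases h : x ∈ goodA E c q A B
    · simp [h]
    · have h1 : x + q ∉ goodB c q A B := by
        simp only [goodB, mem_filter, add_sub_cancel_right]; tauto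
      have h2 : x - q ∉ goodA E c q A B := by
        simp only [goodA, mem_filter, sub_add_cancel]; tauto
      have h3 : x ∉ goodB c q A B := by
        simp only [goodB, mem_filter]
        have := hc x hx; tauto
      simp [h, h1, h2, h3]
  rw [Finset.sum_congr rfl this, Finset.sum_add_distrib, ← Finset.sum_filter, Finset.sum_const]
  have : A.filter (fun x => x ∈ goodA E c q A B) = goodA E c q A B := by
    ext x; simp only [goodA, mem_filter]; tauto
  rw [this]; simp [mul_comm]

lemma swp_sumB (E c q : ℤ) (A B : Finset ℤ) (hc : ∀ x, x ∈ A → x ∈ B → x = c) :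
    ∑ x ∈ B, swp E c q A B x = ∑ x ∈ B, x - q * (goodB c q A B).card := by
  have : ∀ x ∈ B, swp E c q A B x = x - if x ∈ goodB c q A B then q else 0 := by
    intro x hx
    unfold swp
    have h1 : x + q ∉ goodB c q A B := by
      simp only [goodB, mem_filter, add_sub_cancel_right]; tauto
    have h3 : x ∉ goodA E c q A B := by
      simp only [goodA, mem_filter]
      have := hc x; tauto
    have h2 : x - q ∉ goodA E c q A B := by
      simp only [goodA, mem_filter, sub_add_cancel]; tauto
    by_cases h : x ∈ goodB c q A B
    · simp [h, h1, h3]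
    · simp [h, h1, h2, h3]
  rw [Finset.sum_congr rfl this, Finset.sum_sub_distrib, ← Finset.sum_filter, Finset.sum_const]
  have : B.filter (fun x => x ∈ goodB c q A B) = goodB c q A B := by
    ext x; simp only [goodB, mem_filter]; tauto
  rw [this]; simp [mul_comm]

/-- Double counting of conflicts. -/
lemma count_pairs (X Y Z : Finset ℤ) (p S : ℕ) (k : ℤ) (hk : k ≠ 0) (hk1 : -2 ≤ k) (hk2 : k ≤ 2)
    (hS : S ≤ p)
    (hw : ∀ a : ℤ, ((Y \ Z).filter fun y => a ≤ y ∧ y ≤ a + 4 * p).card ≤ 4) :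
    ∑ s ∈ range S, (X.filter fun x => x + k * ((p : ℤ) - s) ∈ Y).card
      ≤ 4 * X.card + S * (Y ∩ Z).card := by
  have h1 : ∀ s : ℕ, (X.filter fun x => x + k * ((p : ℤ) - s) ∈ Y).card ≤
      (X.filter fun x => x + k * ((p : ℤ) - s) ∈ Y \ Z).card + (Y ∩ Z).card := by
    intro s
    have e : (X.filter fun x => x + k * ((p : ℤ) - s) ∈ Y) ⊆
      (X.filter fun x => x + k * ((p : ℤ) - s) ∈ Y \ Z) ∪
      (X.filter fun x => x + k * ((p : ℤ) - s) ∈ Y ∩ Z) := by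
      intro x; simp only [mem_union, mem_filter, mem_sdiff, mem_inter]; tauto
    refine (card_le_card e).trans ((card_union_le _ _).trans (Nat.add_le_add_left ?_ _))
    refine card_le_card_of_injOn (fun x => x + k * ((p : ℤ) - s)) ?_ ?_
    · intro x hx
      have hx := (mem_filter.1 (mem_coe.1 hx)).2
      exact hx
    · intro x _ y _ hxy; simpa using hxy
  refine (Finset.sum_le_sum fun s _ => h1 s).trans ?_
  rw [Finset.sum_add_distrib, Finset.sum_const, card_range, smul_eq_mul]
  refine Nat.add_le_add_right ?_ _
  simp only [Finset.card_filter]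
  rw [Finset.sum_comm]
  simp only [← Finset.card_filter]
  rw [mul_comm, ← smul_eq_mul, ← Finset.sum_const]
  refine Finset.sum_le_sum fun x _ => ?_
  refine le_trans ?_ (hw (x - 2 * p))
  refine card_le_card_of_injOn (fun s : ℕ => x + k * ((p : ℤ) - s)) ?_ ?_
  · intro s hs
    have hs := mem_filter.1 (mem_coe.1 hs)
    have hs1 := mem_range.1 hs.1
    refine mem_coe.2 (mem_filter.2 ⟨hs.2, ?_, ?_⟩) <;> dsimp only
    · have : (s : ℤ) ≤ p := by omega
      nlinarith
    · have : (s : ℤ) ≤ p := by omega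
      nlinarith
  · intro s _ s' _ h
    have h : x + k * ((p : ℤ) - s) = x + k * ((p : ℤ) - s') := h
    have h := mul_left_cancel₀ hk (add_left_cancel h)
    omega

lemma edge_count (Y Z : Finset ℤ) (p : ℕ) 
    (hw : ∀ a : ℤ, ((Y \ Z).filter fun y => a ≤ y ∧ y ≤ a + 4 * p).card ≤ 4)
    (a : ℤ) (P : ℤ → Prop) [DecidablePred P] (hP : ∀ y ∈ Y, P y → a ≤ y ∧ y ≤ a + 4 * p) :
    (Y.filter P).card ≤ 4 + (Y ∩ Z).card := by
  have e : Y.filter P ⊆ ((Y \ Z).filter fun y => a ≤ y ∧ y ≤ a + 4 * p) ∪ (Y ∩ Z) := by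
    intro x; have := hP x; simp only [mem_union, mem_filter, mem_sdiff, mem_inter]; tauto
  exact (card_le_card e).trans ((card_union_le _ _).trans (Nat.add_le_add_right (hw a) _))

lemma exists_shift (E c : ℤ) (A B ZA ZB : Finset ℤ) (p S : ℕ) (hS0 : 0 < S) (hS : S ≤ p)
    (hA : ∀ x ∈ A, 1 ≤ x ∧ x ≤ E) (hB : ∀ x ∈ B, 1 ≤ x ∧ x ≤ E)
    (hwA : ∀ a : ℤ, ((A \ ZA).filter fun y => a ≤ y ∧ y ≤ a + 4 * p).card ≤ 4)
    (hwB : ∀ a : ℤ, ((B \ ZB).filter fun y => a ≤ y ∧ y ≤ a + 4 * p).card ≤ 4) :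
    ∃ s < S, S * (A.card + B.card) ≤
      S * ((goodA E c ((p : ℤ) - s) A B).card + (goodB c ((p : ℤ) - s) A B).card)
      + 12 * (A.card + B.card) + S * (10 + 4 * ((A ∩ ZA).card + (B ∩ ZB).card)) := by
  have hcA : ∀ s : ℕ, A.card ≤ (goodA E c ((p : ℤ) - s) A B).card + (1 + (4 + (A ∩ ZA).card)
      + (A.filter fun x => x + 1 * ((p : ℤ) - s) ∈ A).card
      + (A.filter fun x => x + 1 * ((p : ℤ) - s) ∈ B).card
      + (A.filter fun x => x + 2 * ((p : ℤ) - s) ∈ B).card) := by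
    intro s
    have e : A ⊆ goodA E c ((p : ℤ) - s) A B ∪ ({c} ∪ A.filter (fun x => E < x + ((p : ℤ) - s))
      ∪ (A.filter fun x => x + 1 * ((p : ℤ) - s) ∈ A)
      ∪ (A.filter fun x => x + 1 * ((p : ℤ) - s) ∈ B)
      ∪ (A.filter fun x => x + 2 * ((p : ℤ) - s) ∈ B)) := by
      intro x hx
      simp only [goodA, mem_union, mem_filter, one_mul, mem_singleton, ← not_le]
      tauto
    have h2 := edge_count A ZA p hwA (E - p) (fun x => E < x + ((p : ℤ) - s)) (by
      intro y hy h; have := hA y hy; omega)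
    refine (card_le_card e).trans ((card_union_le _ _).trans (Nat.add_le_add_left ?_ _))
    refine (card_union_le _ _).trans (Nat.add_le_add_right ?_ _)
    refine (card_union_le _ _).trans (Nat.add_le_add_right ?_ _)
    refine (card_union_le _ _).trans (Nat.add_le_add_right ?_ _)
    refine (card_union_le _ _).trans ?_
    rw [card_singleton]; omega
  have hcB : ∀ s : ℕ, B.card ≤ (goodB c ((p : ℤ) - s) A B).card + (1 + (4 + (B ∩ ZB).card)
      + (B.filter fun x => x + (-1) * ((p : ℤ) - s) ∈ A).card
      + (B.filter fun x => x + (-1) * ((p : ℤ) - s) ∈ B).card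
      + (B.filter fun x => x + (-2) * ((p : ℤ) - s) ∈ A).card) := by
    intro s
    have e : B ⊆ goodB c ((p : ℤ) - s) A B ∪ ({c} ∪ B.filter (fun x => x - ((p : ℤ) - s) < 1)
      ∪ (B.filter fun x => x + (-1) * ((p : ℤ) - s) ∈ A)
      ∪ (B.filter fun x => x + (-1) * ((p : ℤ) - s) ∈ B)
      ∪ (B.filter fun x => x + (-2) * ((p : ℤ) - s) ∈ A)) := by
      intro x hx
      have e1 : x + (-1) * ((p : ℤ) - s) = x - ((p : ℤ) - s) := by ring
      have e2 : x + (-2) * ((p : ℤ) - s) = x - 2 * ((p : ℤ) - s) := by ring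
      simp only [goodB, mem_union, mem_filter, mem_singleton, ← not_le, e1, e2]
      tauto
    have h2 := edge_count B ZB p hwB 1 (fun x => x - ((p : ℤ) - s) < 1) (by
      intro y hy h; have := hB y hy; omega)
    refine (card_le_card e).trans ((card_union_le _ _).trans (Nat.add_le_add_left ?_ _))
    refine (card_union_le _ _).trans (Nat.add_le_add_right ?_ _)
    refine (card_union_le _ _).trans (Nat.add_le_add_right ?_ _)
    refine (card_union_le _ _).trans (Nat.add_le_add_right ?_ _)
    refine (card_union_le _ _).trans ?_
    rw [card_singleton]; omega
  have a1 := count_pairs A A ZA p S 1 (by norm_num) (by norm_num) (by norm_num) hS hwA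
  have a2 := count_pairs A B ZB p S 1 (by norm_num) (by norm_num) (by norm_num) hS hwB
  have a3 := count_pairs A B ZB p S 2 (by norm_num) (by norm_num) (by norm_num) hS hwB
  have b1 := count_pairs B A ZA p S (-1) (by norm_num) (by norm_num) (by norm_num) hS hwA
  have b2 := count_pairs B B ZB p S (-1) (by norm_num) (by norm_num) (by norm_num) hS hwB
  have b3 := count_pairs B A ZA p S (-2) (by norm_num) (by norm_num) (by norm_num) hS hwA
  by_contra hcon
  push Not at hcon
  have hs := Finset.sum_le_sum fun s (_ : s ∈ range S) => Nat.add_le_add (hcA s) (hcB s)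
  simp only [Finset.sum_add_distrib, Finset.sum_const, card_range, smul_eq_mul] at hs
  have hlt := Finset.sum_lt_sum_of_nonempty (s := range S) ⟨0, mem_range.2 hS0⟩
    fun s hs => hcon s (mem_range.1 hs)
  simp only [Finset.sum_add_distrib, ← Finset.mul_sum, Finset.sum_const, card_range,
    smul_eq_mul] at hlt
  generalize ∑ i ∈ range S, (goodA E c ((p : ℤ) - i) A B).card = GA at *
  generalize ∑ i ∈ range S, (goodB c ((p : ℤ) - i) A B).card = GB at *
  have key : S * (A.card + B.card) ≤ GA + GB + 12 * (A.card + B.card) +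
      S * (10 + 4 * ((A ∩ ZA).card + (B ∩ ZB).card)) := by
    linarith
  have := Nat.mul_le_mul_left S key
  linarith

/-- A window meets few labels. -/
lemma window (p M : ℕ) (hp : 0 < p) (I : Fin M → Finset ℕ) (L : Finset ℕ)
    (hI : ∀ i, Swap.IsAP1 (I i) ∧ 4 * p ≤ (I i).card)
    (hd : (Set.univ : Set (Fin M)).PairwiseDisjoint I)
    (h2 : ∀ i, (L ∩ I i).card ≤ 2) (a : ℤ) :
    (L.filter fun y => (∃ i, y ∈ I i) ∧ a ≤ (y : ℤ) ∧ (y : ℤ) ≤ a + 4 * p).card ≤ 4 := by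
  classical
  let K : Finset (Fin M) := univ.filter fun i => ∃ y ∈ I i, a ≤ (y : ℤ) ∧ (y : ℤ) ≤ a + 4 * p
  have hK : K.card ≤ 2 := by
    by_contra hcon
    push Not at hcon
    obtain ⟨i, hi, j, hj, k, hk, hij, hik, hjk⟩ := Finset.two_lt_card.1 hcon
    choose! lo hi' hle hEq using fun i => (hI i).1
    have hdis : ∀ i j, i ≠ j → hi' i < lo j ∨ hi' j < lo i := by
      intro i j hne
      by_contra hc
      push Not at hc
      have := hd (Set.mem_univ i) (Set.mem_univ j) hne
      have := Finset.disjoint_left.1 this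
      have h3 := this (a := max (lo i) (lo j))
      rw [hEq i, hEq j] at h3
      have h4 := hle i
      have h5 := hle j
      simp only [Finset.mem_Icc] at h3
      omega
    have hlen : ∀ i, lo i + 4 * p ≤ hi' i + 1 := by
      intro i
      have h3 := (hI i).2
      rw [hEq i, Nat.card_Icc] at h3
      omega
    have hm : ∀ i ∈ K, (lo i : ℤ) ≤ a + 4 * p ∧ a ≤ hi' i := by
      intro i hi
      obtain ⟨y, hy, hy1, hy2⟩ := (mem_filter.1 hi).2
      rw [hEq i, Finset.mem_Icc] at hy
      omega
    have := hm i hi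
    have := hm j hj
    have := hm k hk
    have := hlen i
    have := hlen j
    have := hlen k
    have := hdis i j hij
    have := hdis i k hik
    have := hdis j k hjk
    omega
  have e : (L.filter fun y => (∃ i, y ∈ I i) ∧ a ≤ (y : ℤ) ∧ (y : ℤ) ≤ a + 4 * p) ⊆
      K.biUnion fun i => L ∩ I i := by
    intro y hy
    obtain ⟨hy, ⟨i, hi⟩, h⟩ := mem_filter.1 hy
    exact mem_biUnion.2 ⟨i, mem_filter.2 ⟨mem_univ _, y, hi, h⟩, mem_inter.2 ⟨hy, hi⟩⟩
  refine (card_le_card e).trans (card_biUnion_le.trans ?_)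
  calc _ ≤ ∑ i ∈ K, 2 := Finset.sum_le_sum fun i _ => h2 i
    _ ≤ 4 := by rw [Finset.sum_const, smul_eq_mul]; omega

lemma card_incEdges (n : ℕ) (v : Fin n) : (Swap.incEdges n v).card = n - 1 := by
  classical
  have : Swap.incEdges n v = (univ.erase v).image fun w => s(v, w) := by
    ext e
    induction e with | _ a b =>
    simp only [Swap.incEdges, mem_filter, mem_univ, true_and, mem_image, mem_erase, Sym2.mem_iff,
      Sym2.mk_isDiag_iff, and_true, Sym2.eq_iff]
    constructor
    · rintro ⟨rfl | rfl, h⟩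
      · exact ⟨b, fun h' => h h'.symm, by simp⟩
      · exact ⟨a, h, by simp⟩
    · rintro ⟨w, hw, ⟨rfl, rfl⟩ | ⟨rfl, rfl⟩⟩
      · exact ⟨Or.inl rfl, fun h => hw h.symm⟩
      · exact ⟨Or.inr rfl, hw⟩
  rw [this, card_image_of_injective]
  · rw [card_erase_of_mem (mem_univ _), card_univ, Fintype.card_fin]
  · intro a b h
    have h' : s(v, a) = s(v, b) := h
    rcases Sym2.eq_iff.1 h' with ⟨_, h⟩ | ⟨h1, h2⟩
    · exact h
    · exact h2.trans h1

lemma labelSum_swap_le (n p : ℕ) (t t' : Sym2 (Fin n) → ℕ) (h : Swap.IsPSwap n p t t')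
    (v : Fin n) : |Swap.labelSum n t' v - Swap.labelSum n t v| ≤ (p * n : ℕ) := by
  unfold Swap.labelSum
  rw [← Finset.sum_sub_distrib]
  refine (Finset.abs_sum_le_sum_abs _ _).trans ?_
  refine (Finset.sum_le_sum (g := fun _ => (p : ℤ)) fun e he => h.2 e ?_).trans ?_
  · exact (mem_filter.1 he).2.2
  · rw [Finset.sum_const, card_incEdges, nsmul_eq_mul]
    push_cast
    have : ((n - 1 : ℕ) : ℤ) ≤ n := by omega
    nlinarith

lemma diff_le (n p α : ℕ) (t t' : Sym2 (Fin n) → ℕ) (ht : Swap.AlmostSupermagic n α t)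
    (h : Swap.IsPSwap n p t t') (u v : Fin n) :
    |Swap.labelSum n t' u - Swap.labelSum n t' v| ≤ (α + 2 * (p * n) : ℕ) := by
  have h1 := labelSum_swap_le n p t t' h u
  have h2 := labelSum_swap_le n p t t' h v
  have h3 := ht.2 u v
  push_cast at *
  rw [abs_le] at *
  constructor <;> linarith [h1.1, h1.2, h2.1, h2.2, h3.1, h3.2]

lemma robustness_le (n p α : ℕ) (t : Sym2 (Fin n) → ℕ) (ht : Swap.AlmostSupermagic n α t) :
    Swap.robustness n p t ≤ α + 2 * (p * n) := by
  refine csSup_le' ?_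
  rintro d ⟨t', h, u, v, _, hd⟩
  have := diff_le n p α t t' ht h u v
  rw [← hd] at this
  exact_mod_cast this

lemma le_robustness (n p α : ℕ) (t t' : Sym2 (Fin n) → ℕ) (ht : Swap.AlmostSupermagic n α t)
    (h : Swap.IsPSwap n p t t') (u v : Fin n) (huv : u ≠ v) :
    Swap.labelSum n t' u - Swap.labelSum n t' v ≤ (Swap.robustness n p t : ℤ) := by
  have : (Swap.labelSum n t' u - Swap.labelSum n t' v).natAbs ≤ Swap.robustness n p t := by
    refine le_csSup ⟨α + 2 * (p * n), ?_⟩ ⟨t', h, u, v, huv, by simp⟩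
    rintro d ⟨t', h, u, v, _, hd⟩
    have := diff_le n p α t t' ht h u v
    rw [← hd] at this
    exact_mod_cast this
  omega

lemma card_labelSet (n : ℕ) (t : Sym2 (Fin n) → ℕ) (ht : Swap.IsEdgeLabeling n t) (v : Fin n) :
    (Swap.labelSet n t v).card = n - 1 := by
  classical
  rw [← card_incEdges n v, Swap.labelSet, card_image_of_injOn]
  intro e he e' he' h
  exact ht.2.1 (mem_filter.1 (mem_coe.1 he)).2.2 (mem_filter.1 (mem_coe.1 he')).2.2 h

lemma sum_labelSet (n : ℕ) (t : Sym2 (Fin n) → ℕ) (ht : Swap.IsEdgeLabeling n t) (v : Fin n)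
    (f : ℤ → ℤ) :
    ∑ x ∈ (Swap.labelSet n t v).map Nat.castEmbedding, f x
      = ∑ e ∈ Swap.incEdges n v, f (t e) := by
  classical
  rw [Finset.sum_map, Swap.labelSet, Finset.sum_image]
  · rfl
  intro e he e' he' h
  exact ht.2.1 (mem_filter.1 (mem_coe.1 he)).2.2 (mem_filter.1 (mem_coe.1 he')).2.2 h

lemma mem_labelSet_range (n : ℕ) (t : Sym2 (Fin n) → ℕ) (ht : Swap.IsEdgeLabeling n t)
    (v : Fin n) (x : ℤ) (hx : x ∈ (Swap.labelSet n t v).map Nat.castEmbedding) :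
    1 ≤ x ∧ x ≤ (Swap.eps n : ℤ) := by
  classical
  obtain ⟨y, hy, rfl⟩ := mem_map.1 hx
  obtain ⟨e, he, rfl⟩ := mem_image.1 hy
  have := ht.1 (mem_filter.1 he).2.2
  simp only [Set.mem_Icc, Nat.castEmbedding_apply] at *
  omega

lemma window_cast (p M : ℕ) (hp : 0 < p) (I : Fin M → Finset ℕ) (L : Finset ℕ)
    (hI : ∀ i, Swap.IsAP1 (I i) ∧ 4 * p ≤ (I i).card)
    (hd : (Set.univ : Set (Fin M)).PairwiseDisjoint I)
    (h2 : ∀ i, (L ∩ I i).card ≤ 2) (a : ℤ) :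
    ((L.map (Nat.castEmbedding (R := ℤ)) \ (L \ univ.biUnion I).map Nat.castEmbedding).filter
      fun y => a ≤ y ∧ y ≤ a + 4 * p).card ≤ 4 := by
  classical
  refine le_trans ?_ (window p M hp I L hI hd h2 a)
  rw [← card_map (Nat.castEmbedding (R := ℤ))]
  refine card_le_card ?_
  intro x hx
  obtain ⟨hx, h⟩ := mem_filter.1 hx
  obtain ⟨hx, h'⟩ := mem_sdiff.1 hx
  obtain ⟨y, hy, rfl⟩ := mem_map.1 hx
  refine mem_map_of_mem _ (mem_filter.2 ⟨hy, ?_, h⟩)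
  by_contra hc
  refine h' (mem_map_of_mem _ (mem_sdiff.2 ⟨hy, ?_⟩))
  simpa using hc

lemma robust_lower (n p α S M : ℕ) (t : Sym2 (Fin n) → ℕ) (ht : Swap.AlmostSupermagic n α t)
    (hS0 : 0 < S) (hS : S ≤ p) (I : Fin M → Finset ℕ)
    (hI : ∀ i, Swap.IsAP1 (I i) ∧ 4 * p ≤ (I i).card)
    (hd : (Set.univ : Set (Fin M)).PairwiseDisjoint I)
    (u v : Fin n) (huv : u ≠ v)
    (hu : ∀ i, (Swap.labelSet n t u ∩ I i).card ≤ 2)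
    (hv : ∀ i, (Swap.labelSet n t v ∩ I i).card ≤ 2) :
    ∃ s < S, ∃ G : ℕ, ((p : ℤ) - s) * G ≤ Swap.robustness n p t + α ∧ G ≤ 2 * (n - 1) ∧
      S * (2 * (n - 1)) ≤ S * G + 12 * (2 * (n - 1)) +
        S * (10 + 4 * ((Swap.labelSet n t u \ univ.biUnion I).card +
          (Swap.labelSet n t v \ univ.biUnion I).card)) := by
  classical
  have hlab := ht.1
  set A := (Swap.labelSet n t u).map (Nat.castEmbedding (R := ℤ)) with hAdef
  set B := (Swap.labelSet n t v).map (Nat.castEmbedding (R := ℤ)) with hBdef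
  set E : ℤ := (Swap.eps n : ℤ) with hE
  set c : ℤ := (t s(u, v) : ℤ) with hcdef
  have hA : ∀ x ∈ A, 1 ≤ x ∧ x ≤ E := mem_labelSet_range n t hlab u
  have hB : ∀ x ∈ B, 1 ≤ x ∧ x ≤ E := mem_labelSet_range n t hlab v
  have hcA : A.card = n - 1 := by rw [hAdef, card_map, card_labelSet n t hlab]
  have hcB : B.card = n - 1 := by rw [hBdef, card_map, card_labelSet n t hlab]
  have hc : ∀ x, x ∈ A → x ∈ B → x = c := by
    intro x hxA hxB
    obtain ⟨y, hy, rfl⟩ := mem_map.1 hxA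
    obtain ⟨y', hy', hyy⟩ := mem_map.1 hxB
    have hyy : y' = y := by simpa using hyy
    subst hyy
    obtain ⟨e, he, rfl⟩ := mem_image.1 hy
    obtain ⟨e', he', hee⟩ := mem_image.1 hy'
    have he := (mem_filter.1 he).2
    have he' := (mem_filter.1 he').2
    have := hlab.2.1 he'.2 he.2 hee
    subst this
    have := (Sym2.mem_and_mem_iff huv).1 ⟨he.1, he'.1⟩
    subst this
    rfl
  obtain ⟨s, hs, hcount⟩ := exists_shift E c A B
    ((Swap.labelSet n t u \ univ.biUnion I).map Nat.castEmbedding)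
    ((Swap.labelSet n t v \ univ.biUnion I).map Nat.castEmbedding) p S hS0 hS hA hB
    (window_cast p M (by omega) I _ hI hd hu) (window_cast p M (by omega) I _ hI hd hv)
  set q : ℤ := (p : ℤ) - s with hq
  have hq0 : 0 ≤ q := by omega
  refine ⟨s, hs, (goodA E c q A B).card + (goodB c q A B).card, ?_, ?_, ?_⟩
  · let t' : Sym2 (Fin n) → ℕ := fun e => (swp E c q A B (t e)).toNat
    have hr : ∀ z : ℤ, 1 ≤ z ∧ z ≤ E → 1 ≤ swp E c q A B z ∧ swp E c q A B z ≤ E :=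
      swp_range E c q A B hq0 hA hB
    have hte : ∀ e : Sym2 (Fin n), ¬ e.IsDiag → 1 ≤ (t e : ℤ) ∧ (t e : ℤ) ≤ E := by
      intro e he
      have h0 := hlab.1 he
      simp only [Set.mem_Icc] at h0
      omega
    have ht' : ∀ e : Sym2 (Fin n), ¬ e.IsDiag → (t' e : ℤ) = swp E c q A B (t e) := by
      intro e he
      have := hr _ (hte e he)
      exact Int.toNat_of_nonneg (by omega)
    have hlab' : Swap.IsEdgeLabeling n t' := by
      refine ⟨?_, ?_, ?_⟩
      · intro e he
        have h0 := ht' e he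
        have h1 := hr _ (hte e he)
        simp only [Set.mem_Icc]
        omega
      · intro e he e' he' h
        refine hlab.2.1 he he' ?_
        have h0 : (t' e : ℤ) = t' e' := by rw [h]
        rw [ht' e he, ht' e' he'] at h0
        have h1 := congrArg (swp E c q A B) h0
        rw [swp_invol E c q A B hc, swp_invol E c q A B hc] at h1
        exact_mod_cast h1
      · intro y hy
        simp only [Set.mem_Icc] at hy
        have h0 := hr y (by omega)
        obtain ⟨e, he, hey⟩ := hlab.2.2 (show (swp E c q A B y).toNat ∈ Set.Icc 1 (Swap.eps n) by
          simp only [Set.mem_Icc]; omega)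
        refine ⟨e, he, ?_⟩
        have h1 := ht' e he
        have h2 : (t e : ℤ) = swp E c q A B y := by
          rw [hey]; exact Int.toNat_of_nonneg (by omega)
        rw [h2, swp_invol E c q A B hc] at h1
        exact_mod_cast h1
    have hswap : Swap.IsPSwap n p t t' := by
      refine ⟨hlab', fun e he => ?_⟩
      rw [ht' e he]
      exact (swp_dist E c q A B hq0 _).trans (by omega)
    have hR := le_robustness n p α t t' ht hswap u v huv
    have hα := (abs_le.1 (ht.2 u v)).1
    have hsum : ∀ w : Fin n, Swap.labelSum n t' w
        = ∑ x ∈ (Swap.labelSet n t w).map Nat.castEmbedding, swp E c q A B x := by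
      intro w
      rw [sum_labelSet n t hlab w]
      exact Finset.sum_congr rfl fun e he => ht' e (mem_filter.1 he).2.2
    have hsum0 : ∀ w : Fin n, Swap.labelSum n t w
        = ∑ x ∈ (Swap.labelSet n t w).map Nat.castEmbedding, x := by
      intro w
      rw [sum_labelSet n t hlab w (fun x => x)]
      rfl
    rw [hsum u, hsum v, ← hAdef, ← hBdef, swp_sumA E c q A B hc, swp_sumB E c q A B hc] at hR
    rw [hsum0 u, hsum0 v, ← hAdef, ← hBdef] at hα
    push_cast
    linarith
  · have h1 : (goodA E c q A B).card ≤ A.card := card_filter_le _ _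
    have h2 : (goodB c q A B).card ≤ B.card := card_filter_le _ _
    omega
  · have h1 : (A ∩ (Swap.labelSet n t u \ univ.biUnion I).map Nat.castEmbedding).card ≤
        (Swap.labelSet n t u \ univ.biUnion I).card :=
      (card_le_card inter_subset_right).trans (card_map _).le
    have h2 : (B ∩ (Swap.labelSet n t v \ univ.biUnion I).map Nat.castEmbedding).card ≤
        (Swap.labelSet n t v \ univ.biUnion I).card :=
      (card_le_card inter_subset_right).trans (card_map _).le
    have h3 := Nat.mul_le_mul_left S (Nat.add_le_add_left (Nat.mul_le_mul_left 4
      (Nat.add_le_add h1 h2)) 10)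
    rw [hcA, hcB, ← two_mul] at hcount
    omega

end SwapAux

theorem stmt7 (p α : ℕ → ℕ) (hadm : Swap.Admissible p)
    (hα : ∃ C : ℝ, ∀ n : ℕ, (α n : ℝ) ≤ C * n)
    (ε : ℝ) (hε : 0 ≤ ε)
    (t : ∀ n : ℕ, Sym2 (Fin n) → ℕ)
    (ht : ∀ n : ℕ, 2 ≤ n → Swap.AlmostSupermagic n (α n) (t n))
    (hstruct : ∀ n : ℕ, 2 ≤ n → ∃ (M : ℕ) (I : Fin M → Finset ℕ) (T : Finset (Fin n)),
      (∀ i, Swap.IsAP1 (I i) ∧ I i ⊆ Finset.Icc 1 (Swap.eps n) ∧ 4 * p n ≤ (I i).card) ∧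
      (Set.univ : Set (Fin M)).PairwiseDisjoint I ∧
      Real.log n ≤ (T.card : ℝ) ∧
      ∀ v ∈ T,
        ((n : ℝ) - 1 - ε * Real.sqrt n
            ≤ ((Swap.labelSet n (t n) v ∩ Finset.univ.biUnion I).card : ℝ)) ∧
        ∀ i, (Swap.labelSet n (t n) v ∩ I i).card ≤ 2) :
    ∀ h : ℕ, 0 < h →
      (∃ pstar : ℕ → ℕ,
        (∀ n : ℕ, (p n : ℤ) - h + 1 ≤ (pstar n : ℤ) ∧ pstar n ≤ p n) ∧
        1 - (3 + ε ^ 2) / (2 * h) ≤ Filter.limsup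
          (fun n : ℕ => (Swap.robustness n (pstar n) (t n) : ℝ) / (2 * pstar n * n))
          Filter.atTop) ∧
      1 - (3 + ε ^ 2) / (2 * h) ≤ Filter.limsup
        (fun n : ℕ => (Swap.robustness n (p n) (t n) : ℝ) / (2 * p n * n)) Filter.atTop := by
  intro h hh
  obtain ⟨C, hC⟩ := hα
  obtain ⟨hp0, hpinf⟩ := hadm
  have hhR : (0 : ℝ) < h := by exact_mod_cast hh
  have hlim_n : Filter.Tendsto (fun n : ℕ => (n : ℝ)) Filter.atTop Filter.atTop :=
    tendsto_natCast_atTop_atTop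
  have hlim_p : Filter.Tendsto (fun n : ℕ => (p n : ℝ)) Filter.atTop Filter.atTop :=
    tendsto_natCast_atTop_atTop.comp hpinf
  have hlim_s : Filter.Tendsto (fun n : ℕ => Real.sqrt n) Filter.atTop Filter.atTop :=
    Real.tendsto_sqrt_atTop.comp hlim_n
  have herr : Filter.Tendsto (fun n : ℕ => 6 / (n : ℝ) + 4 * ε / Real.sqrt n
      + (16 * h + C / 2) / (p n : ℝ)) Filter.atTop (nhds 0) := by
    have := ((hlim_n.const_div_atTop 6).add (hlim_s.const_div_atTop (4 * ε))).add
      (hlim_p.const_div_atTop (16 * h + C / 2))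
    simpa using this
  have hgap : (0 : ℝ) < 3 / (4 * h) := by positivity
  have hev_err := herr.eventually (gt_mem_nhds hgap)
  have hlog : ∀ᶠ n : ℕ in Filter.atTop, 1 < Real.log n :=
    (Real.tendsto_log_atTop.comp hlim_n).eventually_gt_atTop 1
  have hlow : ∀ᶠ n : ℕ in Filter.atTop, 1 - (3 + ε ^ 2) / (2 * h) ≤
      (Swap.robustness n (p n) (t n) : ℝ) / (2 * p n * n) := by
    filter_upwards [hev_err, hlog, Filter.eventually_ge_atTop 2,
      hpinf.eventually_ge_atTop (16 * h)] with n hn1 hn2 hn3 hn4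
    obtain ⟨M, I, T, hI, hd, hT, hTv⟩ := hstruct n hn3
    have hT1 : 1 < T.card := by exact_mod_cast hn2.trans_le hT
    obtain ⟨u, hu, v, hv, huv⟩ := Finset.one_lt_card.1 hT1
    obtain ⟨s, hs, G, h1, h2, h3⟩ := SwapAux.robust_lower n (p n) (α n) (16 * h) M (t n) (ht n hn3)
      (by omega) hn4 I (fun i => ⟨(hI i).1, (hI i).2.2⟩) hd u v huv (hTv u hu).2 (hTv v hv).2
    have hout : ∀ w ∈ T, ((Swap.labelSet n (t n) w \ Finset.univ.biUnion I).card : ℝ)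
        ≤ ε * Real.sqrt n := by
      intro w hw
      have e1 := Finset.card_sdiff_add_card_inter (Swap.labelSet n (t n) w) (Finset.univ.biUnion I)
      rw [SwapAux.card_labelSet n (t n) (ht n hn3).1] at e1
      have e2 := (hTv w hw).1
      have e3 : ((Swap.labelSet n (t n) w \ Finset.univ.biUnion I).card : ℝ) +
        ((Swap.labelSet n (t n) w ∩ Finset.univ.biUnion I).card : ℝ) = n - 1 := by
        have e4 : (n : ℝ) = ((n - 1 : ℕ) : ℝ) + 1 := by
          have : n = (n - 1) + 1 := by omega
          exact_mod_cast this
        rw [e4, ← e1]; push_cast; ring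
      linarith
    have hou := hout u hu
    have hov := hout v hv
    have hnR : (0 : ℝ) < n := by exact_mod_cast (by omega : 0 < n)
    have hpR : (16 * h : ℝ) ≤ p n := by exact_mod_cast hn4
    have hpR0 : (0 : ℝ) < p n := by linarith
    have hsq : Real.sqrt n * Real.sqrt n = n := Real.mul_self_sqrt hnR.le
    have hsq0 : 0 < Real.sqrt n := Real.sqrt_pos.2 hnR
    have hN : ((n - 1 : ℕ) : ℝ) = n - 1 := by
      rw [Nat.cast_sub (by omega)]; simp
    have h1R : ((p n : ℝ) - s) * G ≤ Swap.robustness n (p n) (t n) + α n := by exact_mod_cast h1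
    have h2R : (G : ℝ) ≤ 2 * (n - 1) := by rw [← hN]; exact_mod_cast h2
    have h3R : (16 * h : ℝ) * (2 * (n - 1)) ≤ 16 * h * G + 12 * (2 * (n - 1)) +
        16 * h * (10 + 4 * ((Swap.labelSet n (t n) u \ Finset.univ.biUnion I).card +
          (Swap.labelSet n (t n) v \ Finset.univ.biUnion I).card)) := by
      rw [← hN]; exact_mod_cast h3
    have hsR : (s : ℝ) ≤ 16 * h := by exact_mod_cast hs.le
    have hG0 : (0 : ℝ) ≤ G := Nat.cast_nonneg _
    have hCn := hC n
    have hGlow : 2 * (n : ℝ) - 3 / (2 * h) * n - 12 - 8 * ε * Real.sqrt n ≤ G := by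
      have e1 : (16 * h : ℝ) * (2 * (n - 1)) ≤ 16 * h * (G + 3 / (2 * h) * n +
          (10 + 4 * (2 * (ε * Real.sqrt n)))) := by
        have e2 : (16 * h : ℝ) * (3 / (2 * h) * n) = 24 * n := by field_simp; norm_num
        have e3 : 16 * (h : ℝ) * (10 + 4 * ((Swap.labelSet n (t n) u \ Finset.univ.biUnion I).card +
          (Swap.labelSet n (t n) v \ Finset.univ.biUnion I).card)) ≤
          16 * h * (10 + 4 * (2 * (ε * Real.sqrt n))) := by
          apply mul_le_mul_of_nonneg_left _ (by positivity)
          linarith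
        rw [mul_add, mul_add (16 * (h : ℝ)) (G : ℝ), e2]
        linarith
      have e4 := le_of_mul_le_mul_left e1 (by positivity)
      linarith
    have hR : (p n : ℝ) * (2 * (n : ℝ) - 3 / (2 * h) * n - 12 - 8 * ε * Real.sqrt n)
        - 32 * h * n - C * n ≤ Swap.robustness n (p n) (t n) := by
      have e1 := mul_le_mul_of_nonneg_left hGlow hpR0.le
      have e2 : (s : ℝ) * G ≤ 16 * h * (2 * n) := by
        apply mul_le_mul hsR (by linarith) hG0 (by positivity)
      linarith
    rw [le_div_iff₀ (by positivity)]
    refine le_trans ?_ hR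
    have e5 : (p n : ℝ) * (2 * (n : ℝ) - 3 / (2 * h) * n - 12 - 8 * ε * Real.sqrt n)
        - 32 * h * n - C * n = (1 - 3 / (4 * h) - (6 / (n : ℝ) + 4 * ε / Real.sqrt n
      + (16 * h + C / 2) / (p n : ℝ))) * (2 * p n * n) := by
      have f1 : 4 * ε / Real.sqrt n = 4 * ε * Real.sqrt n / n := by
        rw [div_eq_div_iff hsq0.ne' hnR.ne', mul_assoc (4 * ε) (Real.sqrt n), hsq]
      rw [f1]
      field_simp
      ring
    rw [e5]
    apply mul_le_mul_of_nonneg_right _ (by positivity)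
    have e6 : (3 + ε ^ 2) / (2 * h) = 3 / (4 * h) + 3 / (4 * h) + ε ^ 2 / (2 * h) := by
      field_simp; ring
    have e7 : 0 ≤ ε ^ 2 / (2 * h) := by positivity
    linarith
  have hbdd : Filter.IsBoundedUnder (· ≤ ·) Filter.atTop
      (fun n : ℕ => (Swap.robustness n (p n) (t n) : ℝ) / (2 * p n * n)) := by
    refine ⟨|C| + 1, ?_⟩
    rw [Filter.eventually_map]
    filter_upwards [Filter.eventually_ge_atTop 2, hpinf.eventually_ge_atTop 1] with n hn hp1
    have hr := SwapAux.robustness_le n (p n) (α n) (t n) (ht n hn)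
    have hrR : (Swap.robustness n (p n) (t n) : ℝ) ≤ α n + 2 * (p n * n) := by exact_mod_cast hr
    have hnR : (0 : ℝ) < n := by exact_mod_cast (by omega : 0 < n)
    have hpR : (1 : ℝ) ≤ p n := by exact_mod_cast hp1
    rw [div_le_iff₀ (by positivity)]
    have e1 : C * n ≤ |C| * n := mul_le_mul_of_nonneg_right (le_abs_self C) hnR.le
    have e2 : |C| * n * 1 ≤ |C| * n * (2 * p n) :=
      mul_le_mul_of_nonneg_left (by linarith) (by positivity)
    have := hC n
    linarith
  have hfin := Filter.le_limsup_of_frequently_le hlow.frequently hbdd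
  exact ⟨⟨p, fun n => ⟨by omega, le_rfl⟩, hfin⟩, hfin⟩
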